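/- arXiv:2601.16929 — 2 statements merged into one kernel-verified Lean document; each statement's English description precedes it below -/
import Mathlib

section
/- Let p be a prime with p > 5 and p ≡ 2 or 3 (mod 5) (equivalently, p is inert in ℚ(√5)). Then the coefficients c_{p−1} and c_{2p−2} of x^{p−1} and x^{2p−2} in (x^5 − 5Q·x^3 + 5Q^2·x − 2R)^{(p−1)/2} are divisible by p, i.e. c_{p−1} ≡ 0 (mod p) and c_{2p−2} ≡ 0 (mod p) as polynomials in ℤ[Q,R]. (These are the diagonal entries of the Hasse–Witt matrix of the universal genus-two curve with real multiplication by ℚ(√5).) -/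
/-!
Statement 0: For a prime `p > 5` inert in `ℚ(√5)` (i.e. `p ≡ 2, 3 (mod 5)`),
the coefficients `c_{p-1}` and `c_{2p-2}` of `x^{p-1}` and `x^{2p-2}` in
`(x^5 - 5Q x^3 + 5Q^2 x - 2R)^{(p-1)/2}` vanish modulo `p` as polynomials
in `ℤ[Q,R]` (all their coefficients are divisible by `p`).
-/

open Polynomial

/-- The variable `Q` in `ℤ[Q,R]`. -/
noncomputable def Qv : MvPolynomial (Fin 2) ℤ := MvPolynomial.X 0

/-- The variable `R` in `ℤ[Q,R]`. -/
noncomputable def Rv : MvPolynomial (Fin 2) ℤ := MvPolynomial.X 1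

/-- `f(x) = x^5 - 5Q x^3 + 5Q^2 x - 2R` as a polynomial in `x` over `ℤ[Q,R]`. -/
noncomputable def fpoly : Polynomial (MvPolynomial (Fin 2) ℤ) :=
  X ^ 5 - C (5 * Qv) * X ^ 3 + C (5 * Qv ^ 2) * X - C (2 * Rv)

/-- `c_l = c_l(Q,R)`, the coefficient of `x^l` in `f(x)^{(p-1)/2}`. -/
noncomputable def ccoef (p l : ℕ) : MvPolynomial (Fin 2) ℤ :=
  (fpoly ^ ((p - 1) / 2)).coeff l

namespace Polynomial

theorem dickson_one_zero {A : Type*} [CommRing A] (a : A) : dickson 1 a 0 = C 2 := by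
  rw [dickson_zero, Nat.cast_one, map_ofNat]
  norm_num

theorem eval_add_dickson_one {A : Type*} [CommRing A] (u v : A) (n : ℕ) :
    (dickson 1 (u * v) n).eval (u + v) = u ^ n + v ^ n := by
  induction n using Nat.twoStepInduction with
  | zero => simp [dickson_zero]; norm_num
  | one => simp
  | more n h₀ h₁ =>
    rw [dickson_add_two, eval_sub, eval_mul, eval_mul, eval_X, eval_C, h₀, h₁]
    ring

theorem coeff_dickson_one_eq_zero {A : Type*} [CommRing A] (a : A) (n l : ℕ)
    (h : n < l ∨ l + 1 = n) : (dickson 1 a n).coeff l = 0 := by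
  induction n using Nat.twoStepInduction generalizing l with
  | zero =>
    have hl : l ≠ 0 := by omega
    rw [dickson_one_zero, coeff_C_of_ne_zero hl]
  | one =>
    rw [dickson_one, coeff_X_of_ne_one (by omega)]
  | more n h₀ h₁ =>
    obtain ⟨l, rfl⟩ : ∃ k, l = k + 1 := ⟨l - 1, by omega⟩
    rw [dickson_add_two, coeff_sub, coeff_X_mul, coeff_C_mul, h₀ _ (by omega), h₁ _ (by omega)]
    simp

theorem dickson_one_five {A : Type*} [CommRing A] (a : A) :
    dickson 1 a 5 = X ^ 5 - C (5 * a) * X ^ 3 + C (5 * a ^ 2) * X := by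
  simp only [dickson, Nat.cast_one, map_mul, map_pow, map_ofNat]
  ring

section IsAlgClosed

variable {K : Type*} [Field K] [IsAlgClosed K]

theorem exists_add_eq_and_mul_eq (x a : K) : ∃ u v : K, u + v = x ∧ u * v = a := by
  have hd : (X ^ 2 - C x * X + C a : K[X]).degree ≠ 0 := by
    have : (X ^ 2 - C x * X + C a : K[X]).degree = 2 := by compute_degree!
    rw [this]; decide
  obtain ⟨u, hu⟩ := IsAlgClosed.exists_root _ hd
  simp only [IsRoot.def, eval_add, eval_sub, eval_mul, eval_pow, eval_X, eval_C] at hu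
  exact ⟨u, x - u, by ring, by linear_combination -hu⟩

theorem dickson_one_mul_dickson_one (a : K) (m r : ℕ) :
    dickson 1 a (m + r) * dickson 1 a m = dickson 1 a (2 * m + r) + C (a ^ m) * dickson 1 a r := by
  refine Polynomial.funext fun x => ?_
  obtain ⟨u, v, rfl, rfl⟩ := exists_add_eq_and_mul_eq x a
  simp only [eval_mul, eval_add, eval_C, eval_add_dickson_one]
  ring

theorem dickson_one_char (p : ℕ) [Fact p.Prime] [CharP K p] (a : K) :
    dickson 1 a p = X ^ p := by
  refine Polynomial.funext fun x => ?_
  obtain ⟨u, v, rfl, rfl⟩ := exists_add_eq_and_mul_eq x a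
  rw [eval_add_dickson_one, eval_pow, eval_X, add_pow_char]

theorem dickson_one_char_add (p : ℕ) [Fact p.Prime] [CharP K p] (a : K) {r : ℕ} (hr : r ≤ p) :
    dickson 1 a (p + r) = dickson 1 a r * X ^ p - C (a ^ r) * dickson 1 a (p - r) := by
  have h := dickson_one_mul_dickson_one a r (p - r)
  rw [show r + (p - r) = p by omega, show 2 * r + (p - r) = p + r by omega,
    dickson_one_char p] at h
  linear_combination -h

theorem dickson_one_two_mul_char_add (p : ℕ) [Fact p.Prime] [CharP K p] (a : K) (r : ℕ) :
    dickson 1 a (2 * p + r) = dickson 1 a (p + r) * X ^ p - C (a ^ p) * dickson 1 a r := by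
  have h := dickson_one_mul_dickson_one a p r
  rw [dickson_one_char p] at h
  linear_combination -h

theorem coeff_char_sub_one_dickson_one (p : ℕ) [Fact p.Prime] [CharP K p] (a : K) {m : ℕ}
    (hm : m < 3 * p - 1) (h₁ : m + 1 ≠ p) (h₂ : m ≠ p + 1) :
    (dickson 1 a m).coeff (p - 1) = 0 := by
  have hp := (Fact.out : p.Prime).two_le
  rcases lt_or_ge m p with h | h
  · exact coeff_dickson_one_eq_zero _ _ _ (by omega)
  obtain ⟨r, rfl⟩ := Nat.exists_eq_add_of_le h
  rcases le_or_gt r p with hr | hr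
  · rw [dickson_one_char_add p a hr, coeff_sub, coeff_C_mul, coeff_mul_X_pow',
      if_neg (by omega), coeff_dickson_one_eq_zero _ _ _ (by omega)]
    simp
  · obtain ⟨s, rfl⟩ := Nat.exists_eq_add_of_le hr.le
    rw [← add_assoc, ← two_mul, dickson_one_two_mul_char_add, coeff_sub, coeff_C_mul,
      coeff_mul_X_pow', if_neg (by omega), coeff_dickson_one_eq_zero _ _ _ (by omega)]
    simp

theorem coeff_two_mul_char_sub_two_dickson_one (p : ℕ) [Fact p.Prime] [CharP K p] (hp : 2 < p)
    (a : K) {m : ℕ} (hm : m < 3 * p - 1) (h₁ : m + 2 ≠ 2 * p) (h₂ : m ≠ 2 * p + 2) :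
    (dickson 1 a m).coeff (2 * p - 2) = 0 := by
  rcases lt_or_ge m p with h | h
  · exact coeff_dickson_one_eq_zero _ _ _ (by omega)
  obtain ⟨r, rfl⟩ := Nat.exists_eq_add_of_le h
  have hsub : 2 * p - 2 - p = p - 2 := by omega
  rcases lt_or_ge r p with hr | hr
  · rw [dickson_one_char_add p a hr.le, coeff_sub, coeff_C_mul, coeff_mul_X_pow',
      if_pos (by omega), hsub, coeff_dickson_one_eq_zero _ r _ (by omega),
      coeff_dickson_one_eq_zero _ _ _ (by omega)]
    simp
  · obtain ⟨s, rfl⟩ := Nat.exists_eq_add_of_le hr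
    rw [← add_assoc, ← two_mul, dickson_one_two_mul_char_add, coeff_sub, coeff_C_mul,
      coeff_mul_X_pow', if_pos (by omega), hsub, dickson_one_char_add p a (by omega), coeff_sub,
      coeff_C_mul, coeff_mul_X_pow', if_neg (by omega),
      coeff_dickson_one_eq_zero _ s _ (by omega)]
    rcases eq_or_ne s 0 with rfl | hs
    · rw [Nat.sub_zero, dickson_one_char, coeff_X_pow, if_neg (by omega)]
      simp
    · rw [coeff_dickson_one_eq_zero _ _ _ (by omega)]
      simp

/-- Powers of `D₅ - b` lie in the span of the Dickson polynomials `D₅ⱼ`, in dual form. -/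
theorem map_dickson_one_five_sub_pow_eq_zero (a b : K) (n : ℕ) (φ : K[X] →ₗ[K] K)
    (hφ : ∀ j ≤ n, φ (dickson 1 a (5 * j)) = 0) (h2 : (2 : K) ≠ 0) :
    φ ((dickson 1 a 5 - C b) ^ n) = 0 := by
  induction n generalizing φ with
  | zero =>
    have h := hφ 0 le_rfl
    rw [mul_zero, dickson_one_zero, ← mul_one (C 2), ← smul_eq_C_mul, map_smul, smul_eq_mul] at h
    simpa [h2] using h
  | succ n ih =>
    rw [pow_succ']
    refine ih (φ ∘ₗ LinearMap.mulLeft K (dickson 1 a 5 - C b)) fun j hj => ?_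
    rw [LinearMap.comp_apply, LinearMap.mulLeft_apply, sub_mul, map_sub, ← smul_eq_C_mul,
      map_smul, hφ j (by omega), smul_zero, sub_zero]
    rcases j with _ | j
    · rw [mul_zero, dickson_one_zero, mul_comm, ← smul_eq_C_mul, map_smul, hφ 1 (by omega), smul_zero]
    · have h := dickson_one_mul_dickson_one a 5 (5 * j)
      rw [show 5 + 5 * j = 5 * (j + 1) by ring, show 2 * 5 + 5 * j = 5 * (j + 2) by ring] at h
      rw [mul_comm, h, map_add, ← smul_eq_C_mul, map_smul, hφ _ (by omega), hφ _ (by omega),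
        smul_zero, add_zero]

end IsAlgClosed

end Polynomial

/-- A coefficient of `f ^ ((p - 1) / 2)` vanishes modulo `p` as soon as it does for every Dickson
polynomial `D₅ⱼ` of degree at most `5 (p - 1) / 2` in characteristic `p`. -/
theorem dvd_coeff_ccoef_of_coeff_dickson (p l : ℕ) [Fact p.Prime] (hp : 2 < p)
    (h : ∀ (K : Type) [Field K] [IsAlgClosed K] [CharP K p] (a : K), ∀ j ≤ (p - 1) / 2,
      (dickson 1 a (5 * j)).coeff l = 0) (m : Fin 2 →₀ ℕ) :
    (p : ℤ) ∣ MvPolynomial.coeff m (ccoef p l) := by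
  let A := MvPolynomial (Fin 2) (ZMod p)
  let K := AlgebraicClosure (FractionRing A)
  let ι : A →+* K := (algebraMap (FractionRing A) K).comp (algebraMap A (FractionRing A))
  have hι : Function.Injective ι :=
    (algebraMap (FractionRing A) K).injective.comp (IsFractionRing.injective A (FractionRing A))
  have : CharP K p := charP_of_injective_ringHom hι p
  let g : MvPolynomial (Fin 2) ℤ →+* K := ι.comp (MvPolynomial.map (Int.castRingHom (ZMod p)))
  have hf : fpoly.map g = dickson 1 (g Qv) 5 - C (2 * g Rv) := by
    rw [dickson_one_five]
    simp only [fpoly, Polynomial.map_sub, Polynomial.map_add, Polynomial.map_mul,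
      Polynomial.map_pow, map_X, map_C, map_mul, map_pow, map_ofNat g]
  have h2 : (2 : K) ≠ 0 := Ring.two_ne_zero (by rw [ringChar.eq K p]; omega)
  have hg : g (ccoef p l) = 0 := by
    rw [ccoef, ← coeff_map, Polynomial.map_pow, hf]
    exact map_dickson_one_five_sub_pow_eq_zero _ _ _ (lcoeff K l) (h K _) h2
  have hA : MvPolynomial.map (Int.castRingHom (ZMod p)) (ccoef p l) = 0 :=
    hι (hg.trans (map_zero ι).symm)
  rw [← ZMod.intCast_zmod_eq_zero_iff_dvd]
  simpa [MvPolynomial.coeff_map] using congrArg (MvPolynomial.coeff m) hA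

theorem hasse_witt_diagonal_vanish_inert
    (p : ℕ) (hp : p.Prime) (hp5 : 5 < p) (hmod : p % 5 = 2 ∨ p % 5 = 3) :
    (∀ m : Fin 2 →₀ ℕ, (p : ℤ) ∣ MvPolynomial.coeff m (ccoef p (p - 1))) ∧
    (∀ m : Fin 2 →₀ ℕ, (p : ℤ) ∣ MvPolynomial.coeff m (ccoef p (2 * p - 2))) := by
  have : Fact p.Prime := ⟨hp⟩
  constructor
  · refine dvd_coeff_ccoef_of_coeff_dickson p _ (by omega) fun K _ _ _ a j hj => ?_
    exact coeff_char_sub_one_dickson_one p a (by omega) (by omega) (by omega)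
  · refine dvd_coeff_ccoef_of_coeff_dickson p _ (by omega) fun K _ _ _ a j hj => ?_
    exact coeff_two_mul_char_sub_two_dickson_one p (by omega) a (by omega) (by omega) (by omega)
end

section
/- Let p be a prime with p > 5 and p ≡ 1 or 4 (mod 5) (equivalently, p is split in ℚ(√5)). Then the coefficients c_{p−2} and c_{2p−1} of x^{p−2} and x^{2p−1} in (x^5 − 5Q·x^3 + 5Q^2·x − 2R)^{(p−1)/2} are divisible by p, i.e. c_{p−2} ≡ 0 (mod p) and c_{2p−1} ≡ 0 (mod p) as polynomials in ℤ[Q,R]. (These are the anti-diagonal entries of the Hasse–Witt matrix of the universal genus-two curve with real multiplication by ℚ(√5).) -/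
/-!
Statement 1: For a prime `p > 5` split in `ℚ(√5)` (i.e. `p ≡ 1, 4 (mod 5)`),
the coefficients `c_{p-2}` and `c_{2p-1}` of `x^{p-2}` and `x^{2p-1}` in
`(x^5 - 5Q x^3 + 5Q^2 x - 2R)^{(p-1)/2}` vanish modulo `p` as polynomials
in `ℤ[Q,R]` (all their coefficients are divisible by `p`).
-/

open Polynomial

namespace LaurentPolynomial

variable {S : Type*} [CommRing S]

/-- The substitution `x = T + q T⁻¹`. -/
noncomputable def joukowsky (q : S) : S[T;T⁻¹] := T 1 + C q * T (-1)

/-- The image `T - q T⁻¹` of `T + q T⁻¹` under the Euler operator `T d/dT`. -/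
noncomputable def joukowskyDiff (q : S) : S[T;T⁻¹] := T 1 - C q * T (-1)

theorem coeff_T_mul (n : ℤ) (h : S[T;T⁻¹]) (m : ℤ) : (T n * h).coeff m = h.coeff (m - n) := by
  rw [T, AddMonoidAlgebra.coeff_single_mul_apply, one_mul, neg_add_eq_sub]

theorem coeff_C_mul (a : S) (h : S[T;T⁻¹]) (m : ℤ) : (C a * h).coeff m = a * h.coeff m := by
  rw [← smul_eq_C_mul]; rfl

theorem coeff_joukowsky_mul (q : S) (h : S[T;T⁻¹]) (m : ℤ) :
    (joukowsky q * h).coeff m = h.coeff (m - 1) + q * h.coeff (m + 1) := by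
  rw [joukowsky, add_mul, mul_assoc, AddMonoidAlgebra.coeff_add, Finsupp.add_apply, coeff_C_mul,
    coeff_T_mul, coeff_T_mul, sub_neg_eq_add]

theorem coeff_joukowskyDiff_mul (q : S) (h : S[T;T⁻¹]) (m : ℤ) :
    (joukowskyDiff q * h).coeff m = h.coeff (m - 1) - q * h.coeff (m + 1) := by
  rw [joukowskyDiff, sub_mul, mul_assoc, AddMonoidAlgebra.coeff_sub, Finsupp.sub_apply,
    coeff_C_mul, coeff_T_mul, coeff_T_mul, sub_neg_eq_add]

theorem coeff_one (m : ℤ) : (1 : S[T;T⁻¹]).coeff m = if m = 0 then 1 else 0 := by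
  rw [← map_one C, C_apply]

theorem coeff_joukowsky_pow_of_lt (q : S) (l : ℕ) {m : ℤ} (hm : l < m) :
    (joukowsky q ^ l).coeff m = 0 := by
  induction l generalizing m with
  | zero => rw [pow_zero, coeff_one, if_neg (by simpa using hm.ne')]
  | succ l ih =>
    push_cast at hm
    rw [pow_succ', coeff_joukowsky_mul, ih (by lia), ih (by lia), mul_zero, add_zero]

theorem coeff_joukowsky_pow_self (q : S) (l : ℕ) : (joukowsky q ^ l).coeff (l : ℤ) = 1 := by
  induction l with
  | zero => simp
  | succ l ih =>
    rw [pow_succ', coeff_joukowsky_mul, Nat.cast_succ, add_sub_cancel_right, ih,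
      coeff_joukowsky_pow_of_lt q l (m := l + 1 + 1) (by lia), mul_zero, add_zero]

theorem coeff_joukowsky_pow_of_odd (q : S) (l : ℕ) {m : ℤ} (hm : Odd (m + l)) :
    (joukowsky q ^ l).coeff m = 0 := by
  induction l generalizing m with
  | zero =>
    rw [pow_zero, coeff_one, if_neg]
    rintro rfl
    simp at hm
  | succ l ih =>
    push_cast at hm
    rw [pow_succ', coeff_joukowsky_mul, ih (by grind), ih (by grind), mul_zero, add_zero]

/-- The Euler operator `T d/dT` sends `x ^ (l + 1)` to `(l + 1) x ^ l (T - q T⁻¹)`. -/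
theorem succ_mul_coeff_joukowskyDiff_mul_pow (q : S) (l : ℕ) (m : ℤ) :
    (l + 1 : S) * (joukowskyDiff q * joukowsky q ^ l).coeff m =
      m * (joukowsky q ^ (l + 1)).coeff m := by
  induction l generalizing m with
  | zero =>
    rw [pow_succ', pow_zero, coeff_joukowskyDiff_mul, coeff_joukowsky_mul, coeff_one, coeff_one]
    rcases eq_or_ne m 1 with rfl | h₁
    · simp
    · rcases eq_or_ne m (-1) with rfl | h₂
      · simp
      · rw [if_neg (by lia), if_neg (by lia)]
        simp
  | succ l ih =>
    have h₁ := ih (m - 1)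
    have h₂ := ih (m + 1)
    have h₃ : (joukowskyDiff q * joukowsky q ^ (l + 1)).coeff m =
        (joukowskyDiff q * joukowsky q ^ l).coeff (m - 1) +
          q * (joukowskyDiff q * joukowsky q ^ l).coeff (m + 1) := by
      rw [← coeff_joukowsky_mul, pow_succ', mul_left_comm]
    have h₄ := coeff_joukowskyDiff_mul q (joukowsky q ^ (l + 1)) m
    have h₅ := coeff_joukowsky_mul q (joukowsky q ^ (l + 1)) m
    rw [← pow_succ'] at h₅
    push_cast at h₁ h₂ ⊢
    linear_combination (l + 1 : S) * h₃ + h₁ + q * h₂ + h₄ - (m : S) * h₅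

theorem coeff_joukowskyDiff_mul_pow_self (q : S) (l : ℕ) :
    (joukowskyDiff q * joukowsky q ^ l).coeff (l + 1 : ℤ) = 1 := by
  rw [coeff_joukowskyDiff_mul, coeff_joukowsky_pow_of_lt q l (m := l + 1 + 1) (by lia),
    add_sub_cancel_right, coeff_joukowsky_pow_self, mul_zero, sub_zero]

theorem coeff_joukowskyDiff_mul_pow_of_lt (q : S) {l : ℕ} {m : ℤ} (hm : l + 1 < m) :
    (joukowskyDiff q * joukowsky q ^ l).coeff m = 0 := by
  rw [coeff_joukowskyDiff_mul, coeff_joukowsky_pow_of_lt q l (by lia),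
    coeff_joukowsky_pow_of_lt q l (by lia), mul_zero, sub_zero]

theorem coeff_joukowskyDiff_mul_pow_of_even (q : S) {l : ℕ} {m : ℤ} (hm : Even (m + l)) :
    (joukowskyDiff q * joukowsky q ^ l).coeff m = 0 := by
  rw [coeff_joukowskyDiff_mul, coeff_joukowsky_pow_of_odd q l (by grind),
    coeff_joukowsky_pow_of_odd q l (by grind), mul_zero, sub_zero]

theorem coeff_joukowskyDiff_mul_pow_of_dvd [IsDomain S] (p : ℕ) [CharP S p] (q : S) {l : ℕ}
    {m : ℤ} (hm : (p : ℤ) ∣ m) (hl : ¬ p ∣ l + 1) :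
    (joukowskyDiff q * joukowsky q ^ l).coeff m = 0 := by
  have h := succ_mul_coeff_joukowskyDiff_mul_pow q l m
  rw [(CharP.intCast_eq_zero_iff S p m).mpr hm, zero_mul] at h
  refine (mul_eq_zero.mp h).resolve_left fun h0 => hl ?_
  rw [← CharP.cast_eq_zero_iff S p]
  exact_mod_cast h0

/-- For `q = Q`, `r = R` this is `f(T + Q T⁻¹)`, where `f` is the universal quintic. -/
theorem eval₂_joukowsky_quintic (q r : S) :
    (Polynomial.X ^ 5 - Polynomial.C (5 * q) * Polynomial.X ^ 3 +
      Polynomial.C (5 * q ^ 2) * Polynomial.X - Polynomial.C (2 * r)).eval₂ C (joukowsky q) =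
      T 5 + C (q ^ 5) * T (-5) - C (2 * r) := by
  have h : (C q : S[T;T⁻¹]) = T 1 * (C q * T (-1)) := by rw [mul_left_comm, ← T_add]; simp
  have h5 : (T 5 : S[T;T⁻¹]) = T 1 ^ 5 := by simp
  have hn5 : C (q ^ 5) * (T (-5) : S[T;T⁻¹]) = (C q * T (-1)) ^ 5 := by simp [mul_pow]
  simp only [Polynomial.eval₂_add, Polynomial.eval₂_sub, Polynomial.eval₂_mul,
    Polynomial.eval₂_pow, Polynomial.eval₂_X, Polynomial.eval₂_C, joukowsky, h5, hn5]
  simp only [map_mul, map_pow, map_ofNat]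
  generalize (C q * T (-1) : S[T;T⁻¹]) = v at *
  rw [h]
  ring

theorem coeff_quintic_pow_mul (q r : S) (n : ℕ) (h : S[T;T⁻¹]) {m : ℤ}
    (hm : ∀ k, h.coeff (m + 5 * k) = 0) :
    ((T 5 + C (q ^ 5) * T (-5) - C (2 * r)) ^ n * h).coeff m = 0 := by
  induction n generalizing m with
  | zero => simpa using hm 0
  | succ n ih =>
    rw [pow_succ', mul_assoc, sub_mul, add_mul, mul_assoc, AddMonoidAlgebra.coeff_sub,
      AddMonoidAlgebra.coeff_add, Finsupp.sub_apply, Finsupp.add_apply, coeff_C_mul, coeff_C_mul,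
      coeff_T_mul, coeff_T_mul, ih hm, ih fun k => ?_, ih fun k => ?_]
    · simp
    · convert! hm (k + 1) using 2; ring
    · convert! hm (k - 1) using 2; ring

theorem coeff_mul_eval₂_joukowsky (q : S) (g : Polynomial S) {N : ℕ} (hN : g.natDegree < N)
    (m : ℤ) :
    (joukowskyDiff q * g.eval₂ C (joukowsky q)).coeff m =
      ∑ l ∈ Finset.range N, g.coeff l * (joukowskyDiff q * joukowsky q ^ l).coeff m := by
  rw [Polynomial.eval₂_eq_sum_range' C hN, Finset.mul_sum, AddMonoidAlgebra.coeff_sum,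
    Finset.sum_apply']
  refine Finset.sum_congr rfl fun l _ => ?_
  rw [mul_left_comm, coeff_C_mul]

/-- If `k = 1` or `k = 2`, the coefficient of `x ^ (k p - 1)` in `g` is read off from the
coefficient of `T ^ (k p)` in `g(x) T dx/dT`. -/
theorem coeff_mul_eval₂_joukowsky_of_charP [IsDomain S] (p : ℕ) [CharP S p] (hp : Odd p) (q : S)
    (g : Polynomial S) (hg : g.natDegree + 1 < 3 * p) {k : ℕ} (hk : k = 1 ∨ k = 2) :
    (joukowskyDiff q * g.eval₂ C (joukowsky q)).coeff (k * p : ℤ) = g.coeff (k * p - 1) := by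
  have hp0 := hp.pos
  rw [coeff_mul_eval₂_joukowsky q g (N := 3 * p - 1) (by lia),
    Finset.sum_eq_single (k * p - 1)]
  · have h := coeff_joukowskyDiff_mul_pow_self q (k * p - 1)
    have hkp : ((k * p - 1 : ℕ) : ℤ) + 1 = k * p := by
      rcases hk with rfl | rfl <;> push_cast <;> lia
    rw [hkp] at h
    rw [h, mul_one]
  · intro l hl hlk
    rw [Finset.mem_range] at hl
    by_cases hd : p ∣ l + 1
    · obtain ⟨j, hj⟩ := hd
      have hj3 : j < 3 := by
        by_contra! h
        have := Nat.mul_le_mul_left p h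
        lia
      have hjk : j ≠ k := by
        rintro rfl
        rw [mul_comm j, ← hj] at hlk
        exact hlk rfl
      have hj0 : j ≠ 0 := by rintro rfl; simp at hj
      obtain ⟨rfl, rfl⟩ | ⟨rfl, rfl⟩ : (j = 1 ∧ k = 2) ∨ (j = 2 ∧ k = 1) := by lia
      · rw [coeff_joukowskyDiff_mul_pow_of_lt q (by push_cast; lia), mul_zero]
      · rw [coeff_joukowskyDiff_mul_pow_of_even q, mul_zero]
        grind
    · rw [coeff_joukowskyDiff_mul_pow_of_dvd p q (Dvd.intro_left _ rfl) hd, mul_zero]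
  · intro h
    rw [Finset.mem_range] at h
    rcases hk with rfl | rfl <;> lia

end LaurentPolynomial

section Quintic

open LaurentPolynomial (joukowsky joukowskyDiff)

variable {S : Type*} [CommRing S]

/-- The quintic `x^5 - 5q x^3 + 5q^2 x - 2r` over an arbitrary commutative ring. -/
noncomputable def rmQuintic (q r : S) : S[X] :=
  X ^ 5 - C (5 * q) * X ^ 3 + C (5 * q ^ 2) * X - C (2 * r)

theorem natDegree_rmQuintic_le (q r : S) : (rmQuintic q r).natDegree ≤ 5 := by
  unfold rmQuintic
  compute_degree

variable [IsDomain S] (p : ℕ) [CharP S p]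

theorem coeff_rmQuintic_pow_two_mul_sub_one (hp : Odd p) (hmod : p % 5 = 1 ∨ p % 5 = 4)
    (q r : S) : (rmQuintic q r ^ ((p - 1) / 2)).coeff (2 * p - 1) = 0 := by
  have hdeg := Polynomial.natDegree_pow_le_of_le ((p - 1) / 2) (natDegree_rmQuintic_le q r)
  have h := LaurentPolynomial.coeff_mul_eval₂_joukowsky_of_charP p hp q
    (rmQuintic q r ^ ((p - 1) / 2)) (by lia) (k := 2) (.inr rfl)
  rw [← h, Polynomial.eval₂_pow, rmQuintic, LaurentPolynomial.eval₂_joukowsky_quintic, mul_comm]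
  refine LaurentPolynomial.coeff_quintic_pow_mul _ _ _ _ fun k => ?_
  rw [← mul_one (joukowskyDiff q), LaurentPolynomial.coeff_joukowskyDiff_mul,
    LaurentPolynomial.coeff_one, LaurentPolynomial.coeff_one, if_neg (by push_cast; lia),
    if_neg (by push_cast; lia), mul_zero, sub_zero]

theorem coeff_rmQuintic_pow_sub_two (hp : Odd p) (hmod : p % 5 = 1 ∨ p % 5 = 4) (hp1 : p ≠ 1)
    (q r : S) : (rmQuintic q r ^ ((p - 1) / 2)).coeff (p - 2) = 0 := by
  have hdeg := Polynomial.natDegree_pow_le_of_le ((p - 1) / 2) (natDegree_rmQuintic_le q r)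
  have hdeg' := Polynomial.natDegree_mul_le (p := rmQuintic q r ^ ((p - 1) / 2)) (q := X)
  rw [Polynomial.natDegree_X] at hdeg'
  have h := LaurentPolynomial.coeff_mul_eval₂_joukowsky_of_charP p hp q
    (rmQuintic q r ^ ((p - 1) / 2) * X) (by lia) (k := 1) (.inl rfl)
  rw [show 1 * p - 1 = p - 2 + 1 by lia, Polynomial.coeff_mul_X] at h
  rw [← h, Polynomial.eval₂_mul, Polynomial.eval₂_pow, Polynomial.eval₂_X, rmQuintic,
    LaurentPolynomial.eval₂_joukowsky_quintic, mul_left_comm]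
  refine LaurentPolynomial.coeff_quintic_pow_mul _ _ _ _ fun k => ?_
  rw [← mul_one (joukowsky q), LaurentPolynomial.coeff_joukowskyDiff_mul,
    LaurentPolynomial.coeff_joukowsky_mul, LaurentPolynomial.coeff_joukowsky_mul]
  simp only [LaurentPolynomial.coeff_one]
  rw [if_neg (by push_cast; lia), if_neg (by push_cast; lia), if_neg (by push_cast; lia),
    if_neg (by push_cast; lia)]
  simp

end Quintic

theorem map_ccoef (p l : ℕ) :
    MvPolynomial.map (Int.castRingHom (ZMod p)) (ccoef p l) =
      (rmQuintic (MvPolynomial.X 0 : MvPolynomial (Fin 2) (ZMod p)) (MvPolynomial.X 1) ^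
        ((p - 1) / 2)).coeff l := by
  rw [ccoef, ← Polynomial.coeff_map, Polynomial.map_pow]
  simp [fpoly, rmQuintic, Qv, Rv]

theorem dvd_coeff_of_map_eq_zero {σ : Type*} (p : ℕ) {g : MvPolynomial σ ℤ}
    (hg : MvPolynomial.map (Int.castRingHom (ZMod p)) g = 0) (m : σ →₀ ℕ) :
    (p : ℤ) ∣ MvPolynomial.coeff m g := by
  rw [← ZMod.intCast_zmod_eq_zero_iff_dvd, ← eq_intCast (Int.castRingHom (ZMod p)),
    ← MvPolynomial.coeff_map, hg, MvPolynomial.coeff_zero]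

theorem hasse_witt_antidiagonal_vanish_split
    (p : ℕ) (hp : p.Prime) (hp5 : 5 < p) (hmod : p % 5 = 1 ∨ p % 5 = 4) :
    (∀ m : Fin 2 →₀ ℕ, (p : ℤ) ∣ MvPolynomial.coeff m (ccoef p (p - 2))) ∧
    (∀ m : Fin 2 →₀ ℕ, (p : ℤ) ∣ MvPolynomial.coeff m (ccoef p (2 * p - 1))) := by
  have : Fact p.Prime := ⟨hp⟩
  have hodd : Odd p := hp.odd_of_ne_two (by lia)
  refine ⟨dvd_coeff_of_map_eq_zero p ?_, dvd_coeff_of_map_eq_zero p ?_⟩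
  · rw [map_ccoef, coeff_rmQuintic_pow_sub_two p hodd hmod hp.ne_one]
  · rw [map_ccoef, coeff_rmQuintic_pow_two_mul_sub_one p hodd hmod]
end
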